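/- The simple A-module S₂ has infinite complexity: if ⋯ → P_n → ⋯ → P_0 → S₂ → 0 is a minimal projective resolution of S₂, then there is no b ∈ ℕ for which a constant c > 0 exists with dim_k P_n ≤ c·n^{b−1} for all n ≥ 1. -/

import Mathlib

/-!
We formalize statements about the algebra `A = kQ/J²`, where `Q` is the quiver
`1 ⇄ 2 ⇄ 3` and `J` is the arrow ideal of the path algebra `kQ`.
The algebra `A` is presented by generators and relations as a quotient of the
free algebra on three vertex idempotents and four arrows.
Right `A`-modules are treated as left modules over `Aᵐᵒᵖ`.
-/

open CategoryTheory Opposite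

/-- Generators of the path algebra `kQ`: three vertex idempotents `e i`
and four arrows `ar a`, where the arrows of `Q` are
`α : 1 → 2`, `β : 2 → 1`, `γ : 2 → 3`, `δ : 3 → 2`. -/
inductive QGen : Type
  | e : Fin 3 → QGen
  | ar : Fin 4 → QGen

/-- The sources of the four arrows `α, β, γ, δ` (vertices `1,2,3` are `0,1,2 : Fin 3`). -/
def arrowSrc : Fin 4 → Fin 3 := ![0, 1, 1, 2]

/-- The targets of the four arrows `α, β, γ, δ`. -/
def arrowTgt : Fin 4 → Fin 3 := ![1, 0, 2, 1]

/-- The defining relations of `A = kQ/J²`: the `e i` are orthogonal idempotents summing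
to `1`, the arrows are compatible with their sources and targets, and any product of
two arrows vanishes (`J² = 0`). -/
inductive ARel (k : Type) [Field k] : FreeAlgebra k QGen → FreeAlgebra k QGen → Prop
  | idem (i j : Fin 3) :
      ARel k (FreeAlgebra.ι k (QGen.e i) * FreeAlgebra.ι k (QGen.e j))
        (if i = j then FreeAlgebra.ι k (QGen.e i) else 0)
  | sum : ARel k
      (FreeAlgebra.ι k (QGen.e 0) + FreeAlgebra.ι k (QGen.e 1) + FreeAlgebra.ι k (QGen.e 2)) 1
  | src (a : Fin 4) :
      ARel k (FreeAlgebra.ι k (QGen.e (arrowSrc a)) * FreeAlgebra.ι k (QGen.ar a))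
        (FreeAlgebra.ι k (QGen.ar a))
  | tgt (a : Fin 4) :
      ARel k (FreeAlgebra.ι k (QGen.ar a) * FreeAlgebra.ι k (QGen.e (arrowTgt a)))
        (FreeAlgebra.ι k (QGen.ar a))
  | radsq (a b : Fin 4) :
      ARel k (FreeAlgebra.ι k (QGen.ar a) * FreeAlgebra.ι k (QGen.ar b)) 0

/-- The algebra `A = kQ/J²`. -/
abbrev AlgA (k : Type) [Field k] : Type := RingQuot (ARel k)

/-- Right `A`-modules are left modules over `Aop k = Aᵐᵒᵖ`. -/
abbrev Aop (k : Type) [Field k] : Type := (AlgA k)ᵐᵒᵖ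

/-- The algebra homomorphism `A → k` corresponding to the vertex `i`. -/
noncomputable def simpleAlgHom (k : Type) [Field k] (i : Fin 3) : AlgA k →ₐ[k] k :=
  RingQuot.liftAlgHom k
    ⟨FreeAlgebra.lift k (fun g => match g with
        | QGen.e j => if j = i then (1 : k) else 0
        | QGen.ar _ => 0), by
      intro _x _y h
      induction h with
      | idem i j =>
          simp only [map_mul, FreeAlgebra.lift_ι_apply, apply_ite, map_zero]
          split_ifs <;> simp_all
      | sum =>
          simp only [map_add, map_one, FreeAlgebra.lift_ι_apply]
          fin_cases i <;> simp
      | src a => simp [FreeAlgebra.lift_ι_apply]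
      | tgt a => simp [FreeAlgebra.lift_ι_apply]
      | radsq a b => simp [FreeAlgebra.lift_ι_apply]⟩

/-- The ring homomorphism `Aᵐᵒᵖ → k` corresponding to the vertex `i`. -/
noncomputable def simpleRingHom (k : Type) [Field k] (i : Fin 3) : Aop k →+* k :=
  RingHom.fromOpposite (simpleAlgHom k i).toRingHom (fun _ _ => mul_comm _ _)

/-- The simple right `A`-module `S_{i+1}` at the vertex `i` (one-dimensional over `k`,
with `e i` acting as the identity and all arrows acting by zero).
So `SimpleS k 0 = S₁`, `SimpleS k 1 = S₂` and `SimpleS k 2 = S₃`. -/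
def SimpleS (k : Type) [Field k] (_i : Fin 3) : Type := k

instance (k : Type) [Field k] (i : Fin 3) : AddCommGroup (SimpleS k i) :=
  inferInstanceAs (AddCommGroup k)

instance (k : Type) [Field k] (i : Fin 3) : Module k (SimpleS k i) :=
  inferInstanceAs (Module k k)

noncomputable instance (k : Type) [Field k] (i : Fin 3) : Module (Aop k) (SimpleS k i) :=
  Module.compHom (SimpleS k i) (simpleRingHom k i)

/-- The underlying type of `D(A) = Hom_k(A, k)`. -/
abbrev DualA (k : Type) [Field k] : Type := AlgA k →ₗ[k] k

/-- The right `A`-module structure on `D(A)`: `(φ · a) x = φ (a * x)`. -/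
noncomputable instance (k : Type) [Field k] : Module (Aop k) (DualA k) where
  smul a φ := φ.comp (LinearMap.mulLeft k a.unop)
  one_smul φ := by
    show φ.comp (LinearMap.mulLeft k ((1 : Aop k).unop)) = φ
    ext x; simp
  mul_smul a b φ := by
    show φ.comp (LinearMap.mulLeft k ((a * b).unop)) =
      (φ.comp (LinearMap.mulLeft k b.unop)).comp (LinearMap.mulLeft k a.unop)
    ext x; simp [mul_assoc]
  smul_zero a := by
    show (0 : DualA k).comp (LinearMap.mulLeft k a.unop) = 0
    ext x; simp
  smul_add a φ ψ := by
    show (φ + ψ).comp (LinearMap.mulLeft k a.unop) =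
      φ.comp (LinearMap.mulLeft k a.unop) + ψ.comp (LinearMap.mulLeft k a.unop)
    ext x; simp
  add_smul a b φ := by
    show φ.comp (LinearMap.mulLeft k ((a + b).unop)) =
      φ.comp (LinearMap.mulLeft k a.unop) + φ.comp (LinearMap.mulLeft k b.unop)
    ext x; simp [add_mul]
  zero_smul φ := by
    show φ.comp (LinearMap.mulLeft k ((0 : Aop k).unop)) = 0
    ext x; simp

/-- The right `A`-module `M = A ⊕ D(A)`, where `A` carries the right regular
`A`-module structure. -/
abbrev MA (k : Type) [Field k] : Type := AlgA k × DualA k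

/-- `X` belongs to `add M`: `X` is (isomorphic to) a direct summand of `Mⁿ` for some `n`. -/
def InAdd (k : Type) [Field k] (M X : Type) [AddCommGroup M] [Module (Aop k) M]
    [AddCommGroup X] [Module (Aop k) X] : Prop :=
  ∃ (n : ℕ) (ι : X →ₗ[Aop k] (Fin n → M)) (π : (Fin n → M) →ₗ[Aop k] X),
    π.comp ι = LinearMap.id

/-- `Ext^i_A(X, Y)` for right `A`-modules `X` and `Y`, computed in the abelian
category of all right `A`-modules (which has the same `Ext` groups as `mod A`). -/
noncomputable def ExtA (k : Type) [Field k] (X Y : Type) [AddCommGroup X] [Module (Aop k) X]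
    [AddCommGroup Y] [Module (Aop k) Y] (i : ℕ) : Type :=
  ((Ext ℤ (ModuleCat (Aop k)) i).obj (op (ModuleCat.of (Aop k) X))).obj (ModuleCat.of (Aop k) Y)

/-- The data `(P, ε, d)` is a minimal projective resolution
`⋯ → P 1 → P 0 → N → 0` of the right `A`-module `N`: all the `P n` are projective,
the complex is exact, and all the kernels are superfluous submodules (i.e. each
induced map onto a syzygy is a projective cover). -/
def IsMinimalProjRes (k : Type) [Field k] {N : Type} [AddCommGroup N] [Module (Aop k) N]
    (P : ℕ → Type) [∀ n, AddCommGroup (P n)] [∀ n, Module (Aop k) (P n)]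
    (ε : P 0 →ₗ[Aop k] N) (d : ∀ n, P (n + 1) →ₗ[Aop k] P n) : Prop :=
  (∀ n, Module.Projective (Aop k) (P n)) ∧
  Function.Surjective ε ∧
  LinearMap.range (d 0) = LinearMap.ker ε ∧
  (∀ n, LinearMap.range (d (n + 1)) = LinearMap.ker (d n)) ∧
  (∀ K : Submodule (Aop k) (P 0), K ⊔ LinearMap.ker ε = ⊤ → K = ⊤) ∧
  (∀ n, ∀ K : Submodule (Aop k) (P (n + 1)), K ⊔ LinearMap.ker (d n) = ⊤ → K = ⊤)

namespace AlgA

variable {k : Type} [Field k]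

/-- The vertex idempotent `e i` in `Aᵐᵒᵖ`. -/
noncomputable def vert (k : Type) [Field k] (i : Fin 3) : Aop k :=
  MulOpposite.op (RingQuot.mkAlgHom k (ARel k) (FreeAlgebra.ι k (QGen.e i)))

/-- The arrow `a` in `Aᵐᵒᵖ`. -/
noncomputable def arrow (k : Type) [Field k] (a : Fin 4) : Aop k :=
  MulOpposite.op (RingQuot.mkAlgHom k (ARel k) (FreeAlgebra.ι k (QGen.ar a)))

/-- The augmentation `Aᵐᵒᵖ → k` at the vertex `i`, as an algebra homomorphism. -/
noncomputable def aug (k : Type) [Field k] (i : Fin 3) : Aop k →ₐ[k] k :=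
  AlgHom.fromOpposite (simpleAlgHom k i) (fun _ _ => Commute.all _ _)

lemma vert_mul_vert (i j : Fin 3) :
    vert k i * vert k j = if i = j then vert k i else 0 := by
  have h := RingQuot.mkAlgHom_rel k (ARel.idem (k := k) j i)
  rw [map_mul] at h
  rw [vert, vert, ← MulOpposite.op_mul, h]
  split_ifs with h1 h2 h2
  · rw [h1]
  · exact absurd h1.symm h2
  · exact absurd h2.symm h1
  · simp

lemma sum_vert : ∑ i, vert k i = 1 := by
  have h := RingQuot.mkAlgHom_rel k (ARel.sum (k := k))
  rw [map_add, map_add, map_one] at h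
  rw [Fin.sum_univ_three, vert, vert, vert, ← MulOpposite.op_add, ← MulOpposite.op_add, h, MulOpposite.op_one]

lemma arrow_mul_vert_src (a : Fin 4) : arrow k a * vert k (arrowSrc a) = arrow k a := by
  have h := RingQuot.mkAlgHom_rel k (ARel.src (k := k) a)
  rw [map_mul] at h
  rw [vert, arrow, ← MulOpposite.op_mul, h]

lemma vert_tgt_mul_arrow (a : Fin 4) : vert k (arrowTgt a) * arrow k a = arrow k a := by
  have h := RingQuot.mkAlgHom_rel k (ARel.tgt (k := k) a)
  rw [map_mul] at h
  rw [vert, arrow, ← MulOpposite.op_mul, h]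

lemma arrow_mul_arrow (a b : Fin 4) : arrow k a * arrow k b = 0 := by
  have h := RingQuot.mkAlgHom_rel k (ARel.radsq (k := k) b a)
  rw [map_mul] at h
  rw [arrow, arrow, ← MulOpposite.op_mul, h, map_zero, MulOpposite.op_zero]

lemma vert_mul_arrow (i : Fin 3) (a : Fin 4) :
    vert k i * arrow k a = if i = arrowTgt a then arrow k a else 0 := by
  rw [← vert_tgt_mul_arrow, ← mul_assoc, vert_mul_vert]
  split_ifs with h
  · rw [h]
  · simp

lemma arrow_mul_vert (i : Fin 3) (a : Fin 4) :
    arrow k a * vert k i = if i = arrowSrc a then arrow k a else 0 := by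
  rw [← arrow_mul_vert_src, mul_assoc, vert_mul_vert]
  split_ifs with h1 h2 h2
  · rfl
  · exact absurd h1.symm h2
  · exact absurd h2.symm h1
  · simp

lemma aug_vert (i j : Fin 3) : aug k i (vert k j) = if j = i then 1 else 0 := by
  simp [aug, vert, simpleAlgHom]

lemma aug_arrow (i : Fin 3) (a : Fin 4) : aug k i (arrow k a) = 0 := by
  simp [aug, arrow, simpleAlgHom]

lemma induction {motive : Aop k → Prop} (scalar : ∀ c, motive (algebraMap k (Aop k) c))
    (vert : ∀ i, motive (vert k i)) (arrow : ∀ a, motive (arrow k a))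
    (mul : ∀ r s, motive r → motive s → motive (r * s))
    (add : ∀ r s, motive r → motive s → motive (r + s)) (r : Aop k) : motive r := by
  have key : ∀ x : FreeAlgebra k QGen,
      motive (MulOpposite.op (RingQuot.mkAlgHom k (ARel k) x)) := by
    intro x
    induction x using FreeAlgebra.induction with
    | grade0 c => simpa using scalar c
    | grade1 g =>
      cases g with
      | e i => exact vert i
      | ar a => exact arrow a
    | mul x y ihx ihy =>
      rw [map_mul, MulOpposite.op_mul]
      exact mul _ _ ihy ihx
    | add x y ihx ihy =>
      rw [map_add, MulOpposite.op_add]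
      exact add _ _ ihx ihy
  obtain ⟨x, hx⟩ := RingQuot.mkAlgHom_surjective k (ARel k) r.unop
  simpa [hx] using key x

lemma mul_arrow (r : Aop k) (a : Fin 4) :
    r * arrow k a = aug k (arrowTgt a) r • arrow k a := by
  induction r using AlgA.induction with
  | scalar c => rw [AlgHom.commutes, Algebra.algebraMap_self_apply, Algebra.smul_def]
  | vert i => rw [vert_mul_arrow, aug_vert]; split_ifs <;> simp
  | arrow b => simp [arrow_mul_arrow, aug_arrow]
  | mul r s hr hs => rw [mul_assoc, hs, mul_smul_comm, hr, smul_smul, map_mul, mul_comm]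
  | add r s hr hs => rw [add_mul, hr, hs, map_add, add_smul]

lemma arrow_mul (a : Fin 4) (r : Aop k) :
    arrow k a * r = aug k (arrowSrc a) r • arrow k a := by
  induction r using AlgA.induction with
  | scalar c => rw [AlgHom.commutes, Algebra.algebraMap_self_apply, Algebra.smul_def,
      Algebra.commutes]
  | vert i => rw [arrow_mul_vert, aug_vert]; split_ifs <;> simp
  | arrow b => simp [arrow_mul_arrow, aug_arrow]
  | mul r s hr hs => rw [← mul_assoc, hr, smul_mul_assoc, hs, smul_smul, map_mul]
  | add r s hr hs => rw [mul_add, hr, hs, map_add, add_smul]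

lemma arrowSrc_ne_arrowTgt (a : Fin 4) : arrowSrc a ≠ arrowTgt a := by
  fin_cases a <;> decide

/-- The two-dimensional representation of `A` in which the arrow `a` acts as a matrix unit
and all other arrows act as zero. -/
noncomputable def arrowRep (k : Type) [Field k] (a : Fin 4) :
    AlgA k →ₐ[k] Matrix (Fin 2) (Fin 2) k :=
  RingQuot.liftAlgHom k
    ⟨FreeAlgebra.lift k (fun g => match g with
        | QGen.e j => !![if j = arrowSrc a then 1 else 0, 0; 0, if j = arrowTgt a then 1 else 0]
        | QGen.ar b => !![0, if b = a then 1 else 0; 0, 0]), by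
      intro _x _y h
      have hne := arrowSrc_ne_arrowTgt a
      induction h with
      | idem i j =>
          split_ifs with hij
          · subst hij
            simp only [map_mul, FreeAlgebra.lift_ι_apply]
            ext p q
            fin_cases p <;> fin_cases q <;> simp [ite_apply]
          · simp only [map_mul, FreeAlgebra.lift_ι_apply, map_zero]
            ext p q
            fin_cases p <;> fin_cases q <;> simp [ite_apply] <;> grind
      | sum =>
          simp only [map_add, map_one, FreeAlgebra.lift_ι_apply]
          ext p q
          fin_cases a <;> fin_cases p <;> fin_cases q <;> simp [arrowSrc, arrowTgt]
      | src b =>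
          simp only [map_mul, FreeAlgebra.lift_ι_apply]
          ext p q
          fin_cases p <;> fin_cases q <;> by_cases hb : b = a <;> simp [hb, hne, ite_apply]
      | tgt b =>
          simp only [map_mul, FreeAlgebra.lift_ι_apply]
          ext p q
          fin_cases p <;> fin_cases q <;> by_cases hb : b = a <;> simp [hb, hne.symm]
      | radsq b c =>
          simp only [map_mul, FreeAlgebra.lift_ι_apply, map_zero]
          ext p q
          fin_cases p <;> fin_cases q <;> by_cases hb : b = a <;> simp [hb]⟩

lemma arrowRep_arrow (a b : Fin 4) :
    arrowRep k a (arrow k b).unop 0 1 = if b = a then 1 else 0 := by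
  simp [arrowRep, arrow]

lemma eq_zero_of_sum_smul_arrow_eq_zero (c : Fin 4 → k) (h : ∑ a, c a • arrow k a = 0)
    (a : Fin 4) : c a = 0 := by
  have h1 := congrArg (fun r : Aop k => arrowRep k a r.unop 0 1) h
  simpa [Matrix.sum_apply, arrowRep_arrow] using h1

section Radical

variable {X : Type} [AddCommGroup X] [Module (Aop k) X]

variable (k X) in
/-- The radical of an `A`-module: the submodule of sums of elements in the images of arrows. -/
noncomputable def radical : Submodule (Aop k) X where
  carrier := {x | ∃ y : Fin 4 → X, x = ∑ a, arrow k a • y a}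
  zero_mem' := ⟨0, by simp⟩
  add_mem' := by
    rintro _ _ ⟨y, rfl⟩ ⟨z, rfl⟩
    exact ⟨y + z, by simp [Finset.sum_add_distrib]⟩
  smul_mem' := by
    rintro r _ ⟨y, rfl⟩
    refine ⟨fun a => algebraMap k (Aop k) (aug k (arrowTgt a) r) • y a, ?_⟩
    rw [Finset.smul_sum]
    refine Finset.sum_congr rfl fun a _ => ?_
    rw [smul_smul, smul_smul, mul_arrow, Algebra.smul_def, Algebra.commutes]

lemma mem_radical {x : X} : x ∈ radical k X ↔ ∃ y : Fin 4 → X, x = ∑ a, arrow k a • y a :=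
  Iff.rfl

lemma arrow_smul_mem_radical (a : Fin 4) (x : X) : arrow k a • x ∈ radical k X :=
  ⟨Pi.single a x, by simp [Pi.single_apply]⟩

lemma arrow_smul_eq_zero (a : Fin 4) {x : X} (hx : x ∈ radical k X) : arrow k a • x = 0 := by
  obtain ⟨y, rfl⟩ := hx
  simp [Finset.smul_sum, smul_smul, arrow_mul_arrow]

lemma smul_mem_radical_of_mem {r : Aop k} (hr : r ∈ radical k (Aop k)) (x : X) :
    r • x ∈ radical k X := by
  obtain ⟨y, rfl⟩ := hr
  exact ⟨fun a => y a • x, by simp [Finset.sum_smul, mul_smul]⟩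

lemma sub_sum_aug_mem_radical (r : Aop k) :
    r - ∑ i, aug k i r • vert k i ∈ radical k (Aop k) := by
  induction r using AlgA.induction with
  | scalar c =>
    have : algebraMap k (Aop k) c - ∑ i, aug k i (algebraMap k (Aop k) c) • vert k i = 0 := by
      simp only [AlgHom.commutes, Algebra.algebraMap_self_apply, ← Finset.smul_sum, sum_vert]
      rw [Algebra.algebraMap_eq_smul_one, sub_self]
    rw [this]
    exact zero_mem _
  | vert i => simp [aug_vert]
  | arrow a => simpa [aug_arrow] using arrow_smul_mem_radical (k := k) a (1 : Aop k)
  | mul r s hr hs =>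
    have h : r * s - ∑ i, aug k i (r * s) • vert k i =
        r • (s - ∑ i, aug k i s • vert k i) +
          (r - ∑ i, aug k i r • vert k i) • ∑ i, aug k i s • vert k i := by
      simp only [smul_eq_mul, mul_sub, sub_mul]
      have : (∑ i, aug k i r • vert k i) * ∑ i, aug k i s • vert k i =
          ∑ i, aug k i (r * s) • vert k i := by
        simp [Finset.sum_mul, Finset.mul_sum, vert_mul_vert, smul_smul, mul_comm]
      rw [this]
      abel
    rw [h]
    exact add_mem (Submodule.smul_mem _ _ hs) (smul_mem_radical_of_mem hr _)
  | add r s hr hs =>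
    have h : r + s - ∑ i, aug k i (r + s) • vert k i =
        (r - ∑ i, aug k i r • vert k i) + (s - ∑ i, aug k i s • vert k i) := by
      simp only [map_add, add_smul, Finset.sum_add_distrib]
      abel
    rw [h]
    exact add_mem hr hs

lemma mem_radical_of_aug_eq_zero {r : Aop k} (h : ∀ i, aug k i r = 0) :
    r ∈ radical k (Aop k) := by
  simpa [h] using sub_sum_aug_mem_radical r

/-- For a projective module `P`, the map `⨁ₐ P eₛ₍ₐ₎ / rad → rad P` is injective. -/
lemma vert_smul_mem_radical [Module.Projective (Aop k) X] {x : Fin 4 → X}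
    (h : ∑ a, arrow k a • x a = 0) (a : Fin 4) :
    vert k (arrowSrc a) • x a ∈ radical k X := by
  obtain ⟨s, hs⟩ := Module.Projective.out (R := Aop k) (P := X)
  rw [← hs (vert k (arrowSrc a) • x a), Finsupp.linearCombination_apply]
  refine Submodule.sum_mem _ fun p _ => smul_mem_radical_of_mem ?_ _
  have h0 : ∑ b, arrow k b * s (x b) p = 0 := by
    have := congrArg (fun z => s z p) h
    simpa [Finsupp.finsetSum_apply] using this
  simp only [arrow_mul] at h0
  have h1 := eq_zero_of_sum_smul_arrow_eq_zero _ h0 a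
  refine mem_radical_of_aug_eq_zero fun i => ?_
  rw [map_smul, Finsupp.smul_apply, smul_eq_mul, map_mul, aug_vert]
  split_ifs with hi
  · rw [← hi, h1, mul_zero]
  · simp

end Radical

section Linear

variable {X Y : Type} [AddCommGroup X] [Module (Aop k) X] [Module k X]
  [IsScalarTower k (Aop k) X]
  [AddCommGroup Y] [Module (Aop k) Y] [Module k Y] [IsScalarTower k (Aop k) Y]

/-- A superfluous submodule is contained in the radical. -/
lemma le_radical_of_superfluous (K : Submodule (Aop k) X)
    (hK : ∀ N : Submodule (Aop k) X, N ⊔ K = ⊤ → N = ⊤) : K ≤ radical k X := by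
  intro x hx
  by_contra hxr
  obtain ⟨i, hi⟩ : ∃ i, vert k i • x ∉ radical k X := by
    by_contra! hall
    apply hxr
    rw [← one_smul (Aop k) x, ← sum_vert, Finset.sum_smul]
    exact Submodule.sum_mem _ fun i _ => hall i
  obtain ⟨f, hf, hle⟩ :=
    Submodule.exists_le_ker_of_notMem (p := (radical k X).restrictScalars k) hi
  replace hle : ∀ z ∈ radical k X, f z = 0 := fun z hz => hle hz
  have hg : ∀ (r : Aop k) (z : X), f (vert k i • r • z) = aug k i r * f (vert k i • z) := by
    intro r z
    have h1 := hle _ (Submodule.smul_mem _ (vert k i)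
      (smul_mem_radical_of_mem (sub_sum_aug_mem_radical r) z))
    rw [sub_smul, smul_sub, map_sub, sub_eq_zero] at h1
    rw [h1, Finset.sum_smul, Finset.smul_sum]
    simp only [smul_assoc, smul_comm (vert k i), smul_smul (vert k i), vert_mul_vert]
    simp [ite_smul]
  let N : Submodule (Aop k) X :=
    { carrier := {z | f (vert k i • z) = 0}
      zero_mem' := by simp
      add_mem' := by
        intro y z hy hz
        simp_all [smul_add]
      smul_mem' := by
        intro r z hz
        change f (vert k i • r • z) = 0
        rw [hg, show f (vert k i • z) = 0 from hz, mul_zero] }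
  have hN : N = ⊤ := by
    refine hK N (eq_top_iff.2 fun z _ => ?_)
    set c : k := f (vert k i • z) / f (vert k i • x) with hc
    rw [← sub_add_cancel z (algebraMap k (Aop k) c • x)]
    refine Submodule.add_mem_sup ?_ (Submodule.smul_mem _ _ hx)
    change f (vert k i • (z - algebraMap k (Aop k) c • x)) = 0
    rw [smul_sub, map_sub, hg, AlgHom.commutes, Algebra.algebraMap_self_apply, hc,
      div_mul_cancel₀ _ hf, sub_self]
  have : x ∈ N := hN ▸ Submodule.mem_top
  exact hf this

/-- The `k`-subspace `W e i` of a submodule `W`. -/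
noncomputable def vertexSpace (W : Submodule (Aop k) X) (i : Fin 3) : Submodule k X :=
  W.restrictScalars k ⊓ LinearMap.ker (Algebra.lsmul k k X (vert k i) - 1)

lemma mem_vertexSpace {W : Submodule (Aop k) X} {i : Fin 3} {x : X} :
    x ∈ vertexSpace W i ↔ x ∈ W ∧ vert k i • x = x := by
  simp [vertexSpace, sub_eq_zero]

/-- A `k`-linear section of `d` over its range. -/
lemma exists_section (d : X →ₗ[Aop k] Y) :
    ∃ σ : Y →ₗ[k] X, ∀ w ∈ LinearMap.range d, d (σ w) = w := by
  obtain ⟨τ, hτ⟩ := (d.restrictScalars k).rangeRestrict.exists_rightInverse_of_surjective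
    (LinearMap.range_rangeRestrict _)
  obtain ⟨σ, hσ⟩ := τ.exists_extend
  refine ⟨σ, fun w hw => ?_⟩
  have h1 := congrArg Subtype.val (LinearMap.congr_fun hτ ⟨w, hw⟩)
  rw [← hσ] at h1
  exact h1

lemma finite_radical (d : X →ₗ[Aop k] Y) (W : Submodule (Aop k) Y)
    (hr : LinearMap.range d = W) (hk : LinearMap.ker d = radical k X)
    [Module.Finite k (W.restrictScalars k)] :
    Module.Finite k ((radical k X).restrictScalars k) := by
  obtain ⟨σ, hσ⟩ := exists_section d
  let F : (Fin 4 → W.restrictScalars k) →ₗ[k] X :=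
    ∑ a, (Algebra.lsmul k k X (arrow k a)) ∘ₗ σ ∘ₗ Submodule.subtype _ ∘ₗ LinearMap.proj a
  have hF : LinearMap.range F = (radical k X).restrictScalars k := by
    apply le_antisymm
    · rintro _ ⟨w, rfl⟩
      exact ⟨fun a => σ (w a), by simp [F]⟩
    · rintro _ ⟨y, rfl⟩
      have hy : ∀ a, d (y a) ∈ W := fun a => hr ▸ ⟨_, rfl⟩
      refine ⟨fun a => ⟨d (y a), hy a⟩, ?_⟩
      simp only [F, LinearMap.sum_apply, LinearMap.comp_apply, LinearMap.proj_apply,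
        Algebra.lsmul_coe, Submodule.subtype_apply]
      refine Finset.sum_congr rfl fun a _ => ?_
      rw [← sub_eq_zero, ← smul_sub]
      apply arrow_smul_eq_zero
      rw [← hk, LinearMap.mem_ker, map_sub, hσ _ ⟨_, rfl⟩, sub_self]
  exact hF ▸ inferInstance

lemma finite_of_range_of_ker (d : X →ₗ[Aop k] Y) (W : Submodule (Aop k) Y)
    (hr : LinearMap.range d = W) (hk : LinearMap.ker d = radical k X)
    [Module.Finite k (W.restrictScalars k)] :
    Module.Finite k X := by
  have h1 := finite_radical d W hr hk
  have h2 : Module.Finite k (LinearMap.range (d.restrictScalars k)) := by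
    subst hr
    assumption
  have h3 : Module.Finite k (X ⧸ (radical k X).restrictScalars k) := by
    rw [← hk]
    exact Module.Finite.equiv (d.restrictScalars k).quotKerEquivRange.symm
  exact Module.Finite.of_submodule_quotient ((radical k X).restrictScalars k)

lemma sum_finrank_vertexSpace_le [Module.Projective (Aop k) X] (d : X →ₗ[Aop k] Y)
    (W : Submodule (Aop k) Y) (hr : LinearMap.range d = W)
    (hk : LinearMap.ker d = radical k X) [Module.Finite k (W.restrictScalars k)] (i : Fin 3) :
    ∑ a : {a // arrowTgt a = i}, Module.finrank k (vertexSpace W (arrowSrc a)) ≤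
      Module.finrank k (vertexSpace (radical k X) i) := by
  have hX : Module.Finite k X := finite_of_range_of_ker d W hr hk
  obtain ⟨σ, hσ⟩ := exists_section d
  rw [hr] at hσ
  have hfin : ∀ j, Module.Finite k (vertexSpace W j) := fun j =>
    Submodule.finiteDimensional_of_le (S₂ := W.restrictScalars k) inf_le_left
  rw [← Module.finrank_pi_fintype k]
  let F : ((a : {a // arrowTgt a = i}) → vertexSpace W (arrowSrc a)) →ₗ[k] X :=
    ∑ a : {a // arrowTgt a = i}, (Algebra.lsmul k k X (arrow k a)) ∘ₗ σ ∘ₗ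
      Submodule.subtype _ ∘ₗ LinearMap.proj a
  have hF : ∀ w, F w = ∑ a : {a // arrowTgt a = i}, arrow k a • σ (w a) := by
    intro w
    simp [F]
  have hmem : ∀ w, F w ∈ vertexSpace (radical k X) i := by
    intro w
    rw [hF]
    refine Submodule.sum_mem _ fun a _ => mem_vertexSpace.2 ⟨arrow_smul_mem_radical _ _, ?_⟩
    rw [smul_smul, vert_mul_arrow, if_pos a.2.symm]
  refine LinearMap.finrank_le_finrank_of_injective (f := F.codRestrict _ hmem) ?_
  rw [LinearMap.injective_codRestrict_iff, injective_iff_map_eq_zero]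
  intro w hw
  rw [hF] at hw
  let x : Fin 4 → X := fun a => if h : arrowTgt a = i then σ (w ⟨a, h⟩) else 0
  have hx : ∑ a, arrow k a • x a = 0 := by
    rw [← hw, ← Finset.sum_filter_of_ne (p := fun a => arrowTgt a = i),
      Finset.sum_subtype (p := fun a => arrowTgt a = i) (F := inferInstance) _ (by simp)]
    · refine Finset.sum_congr rfl fun a _ => ?_
      simp [x, a.2]
    · intro a _ ha
      by_contra h
      simp [x, h] at ha
  funext a
  have h1 := vert_smul_mem_radical hx a
  obtain ⟨hwa, hea⟩ := mem_vertexSpace.1 (w a).2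
  rw [← hk, LinearMap.mem_ker, map_smul] at h1
  simp only [x, dif_pos a.2, hσ _ hwa] at h1
  exact Subtype.ext (hea.symm.trans h1)

end Linear

section Resolution

instance (i : Fin 3) : IsScalarTower k (Aop k) (SimpleS k i) where
  smul_assoc c r x := by
    change simpleRingHom k i (c • r) * (id x : k) = c * (simpleRingHom k i r * (id x : k))
    rw [show simpleRingHom k i (c • r) = c * simpleRingHom k i r from
      map_smul (aug k i) c r, mul_assoc]

instance (i : Fin 3) : Module.Finite k (SimpleS k i) := inferInstanceAs (Module.Finite k k)

lemma arrow_smul_simple (a : Fin 4) (i : Fin 3) (x : SimpleS k i) : arrow k a • x = 0 := by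
  change aug k i (arrow k a) * (id x : k) = 0
  rw [aug_arrow, zero_mul]

lemma vert_smul_simple (i : Fin 3) (x : SimpleS k i) : vert k i • x = x := by
  change aug k i (vert k i) * (id x : k) = id x
  rw [aug_vert, if_pos rfl, one_mul]
  rfl

variable {P : ℕ → Type} [∀ n, AddCommGroup (P n)] [∀ n, Module (Aop k) (P n)]
    [∀ n, Module k (P n)] [∀ n, IsScalarTower k (Aop k) (P n)]

lemma ker_eq_radical_zero {i : Fin 3} {ε : P 0 →ₗ[Aop k] SimpleS k i}
    {d : ∀ n, P (n + 1) →ₗ[Aop k] P n} (hres : IsMinimalProjRes k P ε d) :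
    LinearMap.ker ε = radical k (P 0) := by
  refine le_antisymm (le_radical_of_superfluous _ hres.2.2.2.2.1) ?_
  rintro _ ⟨y, rfl⟩
  simp [arrow_smul_simple]

lemma range_eq_radical_and_ker_eq_radical {i : Fin 3} {ε : P 0 →ₗ[Aop k] SimpleS k i}
    {d : ∀ n, P (n + 1) →ₗ[Aop k] P n} (hres : IsMinimalProjRes k P ε d) (n : ℕ) :
    LinearMap.range (d n) = radical k (P n) ∧
      LinearMap.ker (d n) = radical k (P (n + 1)) := by
  have ker_eq : ∀ n, LinearMap.range (d n) = radical k (P n) →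
      LinearMap.ker (d n) = radical k (P (n + 1)) := by
    intro n hn
    refine le_antisymm (le_radical_of_superfluous _ (hres.2.2.2.2.2 n)) ?_
    rintro _ ⟨y, rfl⟩
    have hy : ∀ a, arrow k a • d n (y a) = 0 := fun a =>
      arrow_smul_eq_zero a (hn ▸ ⟨_, rfl⟩)
    simp [hy]
  induction n with
  | zero =>
    have h : LinearMap.range (d 0) = radical k (P 0) :=
      hres.2.2.1.trans (ker_eq_radical_zero hres)
    exact ⟨h, ker_eq 0 h⟩
  | succ n ih =>
    have h := (hres.2.2.2.1 n).trans ih.2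
    exact ⟨h, ker_eq _ h⟩

lemma finite_resolution {i : Fin 3} {ε : P 0 →ₗ[Aop k] SimpleS k i}
    {d : ∀ n, P (n + 1) →ₗ[Aop k] P n} (hres : IsMinimalProjRes k P ε d) (n : ℕ) :
    Module.Finite k (P n) := by
  induction n with
  | zero =>
    exact finite_of_range_of_ker ε ⊤ (LinearMap.range_eq_top.2 hres.2.1)
      (ker_eq_radical_zero hres)
  | succ n ih =>
    obtain ⟨h1, h2⟩ := range_eq_radical_and_ker_eq_radical hres n
    exact finite_of_range_of_ker (d n) _ h1 h2

lemma sum_finrank_vertexSpace_radical_le {i : Fin 3} {ε : P 0 →ₗ[Aop k] SimpleS k i}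
    {d : ∀ n, P (n + 1) →ₗ[Aop k] P n} (hres : IsMinimalProjRes k P ε d) (n : ℕ) (j : Fin 3) :
    ∑ a : {a // arrowTgt a = j}, Module.finrank k (vertexSpace (radical k (P n)) (arrowSrc a)) ≤
      Module.finrank k (vertexSpace (radical k (P (n + 1))) j) := by
  obtain ⟨h1, h2⟩ := range_eq_radical_and_ker_eq_radical hres n
  have := finite_resolution hres n
  have := hres.1 (n + 1)
  exact sum_finrank_vertexSpace_le (d n) _ h1 h2 j

lemma sum_arrowTgt_eq_zero (f : Fin 3 → ℕ) :
    ∑ a : {a // arrowTgt a = 0}, f (arrowSrc a) = f 1 := by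
  have := Finset.sum_subtype (Finset.univ.filter fun a => arrowTgt a = 0)
    (F := inferInstance) (p := fun a => arrowTgt a = 0) (by simp) (fun a => f (arrowSrc a))
  rw [← this, show (Finset.univ.filter fun a => arrowTgt a = 0) = {1} by decide]
  simp [arrowSrc]

lemma sum_arrowTgt_eq_one (f : Fin 3 → ℕ) :
    ∑ a : {a // arrowTgt a = 1}, f (arrowSrc a) = f 0 + f 2 := by
  have := Finset.sum_subtype (Finset.univ.filter fun a => arrowTgt a = 1)
    (F := inferInstance) (p := fun a => arrowTgt a = 1) (by simp) (fun a => f (arrowSrc a))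
  rw [← this, show (Finset.univ.filter fun a => arrowTgt a = 1) = {0, 3} by decide]
  simp [arrowSrc]

lemma sum_arrowTgt_eq_two (f : Fin 3 → ℕ) :
    ∑ a : {a // arrowTgt a = 2}, f (arrowSrc a) = f 1 := by
  have := Finset.sum_subtype (Finset.univ.filter fun a => arrowTgt a = 2)
    (F := inferInstance) (p := fun a => arrowTgt a = 2) (by simp) (fun a => f (arrowSrc a))
  rw [← this, show (Finset.univ.filter fun a => arrowTgt a = 2) = {2} by decide]
  simp [arrowSrc]

lemma two_pow_le_finrank {ε : P 0 →ₗ[Aop k] SimpleS k 1}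
    {d : ∀ n, P (n + 1) →ₗ[Aop k] P n} (hres : IsMinimalProjRes k P ε d) (m : ℕ) :
    2 ^ m ≤ Module.finrank k (P (2 * m)) := by
  let D : ℕ → Fin 3 → ℕ := fun n j => Module.finrank k (vertexSpace (radical k (P n)) j)
  have step0 : ∀ n, D n 1 ≤ D (n + 1) 0 := fun n =>
    (sum_arrowTgt_eq_zero (D n)).symm.le.trans (sum_finrank_vertexSpace_radical_le hres n 0)
  have step1 : ∀ n, D n 0 + D n 2 ≤ D (n + 1) 1 := fun n =>
    (sum_arrowTgt_eq_one (D n)).symm.le.trans (sum_finrank_vertexSpace_radical_le hres n 1)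
  have step2 : ∀ n, D n 1 ≤ D (n + 1) 2 := fun n =>
    (sum_arrowTgt_eq_two (D n)).symm.le.trans (sum_finrank_vertexSpace_radical_le hres n 2)
  have hD : 1 ≤ D 0 0 ∧ 1 ≤ D 0 2 := by
    let T : Submodule (Aop k) (SimpleS k 1) := ⊤
    have hT : Module.finrank k (vertexSpace T 1) = 1 := by
      have : vertexSpace T 1 = ⊤ :=
        eq_top_iff.2 fun x _ => mem_vertexSpace.2 ⟨trivial, vert_smul_simple 1 x⟩
      rw [this, finrank_top]
      exact Module.finrank_self k
    have := hres.1 0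
    have hle := sum_finrank_vertexSpace_le ε T (LinearMap.range_eq_top.2 hres.2.1)
      (ker_eq_radical_zero hres)
    have h0 := hle 0
    have h2 := hle 2
    rw [sum_arrowTgt_eq_zero (fun j => Module.finrank k (vertexSpace T j)), hT] at h0
    rw [sum_arrowTgt_eq_two (fun j => Module.finrank k (vertexSpace T j)), hT] at h2
    exact ⟨h0, h2⟩
  have hpow : ∀ m, 2 ^ m ≤ D (2 * m) 0 ∧ 2 ^ m ≤ D (2 * m) 2 := by
    intro m
    induction m with
    | zero => simpa using hD
    | succ m ih =>
      have h1 := step1 (2 * m)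
      have h0 := step0 (2 * m + 1)
      have h2 := step2 (2 * m + 1)
      rw [show 2 * (m + 1) = 2 * m + 1 + 1 by ring, pow_succ]
      omega
  have := finite_resolution hres (2 * m)
  exact (hpow m).1.trans (Submodule.finrank_le _)

end Resolution

end AlgA

/-- The simple `A`-module `S₂` has infinite complexity: for a minimal projective
resolution `⋯ → P 1 → P 0 → S₂ → 0` there is no `b ∈ ℕ` for which a constant `c > 0`
exists with `dim_k (P n) ≤ c · n^(b-1)` for all `n ≥ 1`. -/
theorem simple_two_has_infinite_complexity (k : Type) [Field k]
    (P : ℕ → Type) [∀ n, AddCommGroup (P n)] [∀ n, Module (Aop k) (P n)]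
    [∀ n, Module k (P n)] [∀ n, IsScalarTower k (Aop k) (P n)]
    (ε : P 0 →ₗ[Aop k] SimpleS k 1) (d : ∀ n, P (n + 1) →ₗ[Aop k] P n)
    (hres : IsMinimalProjRes k P ε d) :
    ¬ ∃ (b : ℕ) (c : ℝ), 0 < c ∧
        ∀ n : ℕ, 1 ≤ n →
          (Module.finrank k (P n) : ℝ) ≤ c * (n : ℝ) ^ ((b : ℝ) - 1) := by
  rintro ⟨b, c, hc, h⟩
  have hlim := (tendsto_pow_const_div_const_pow_of_one_lt b (one_lt_two (α := ℝ))).const_mul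
    (c * 2 ^ b)
  rw [mul_zero] at hlim
  obtain ⟨m, hm, hm1⟩ :=
    ((hlim.eventually_lt_const one_pos).and (Filter.eventually_ge_atTop 1)).exists
  have h1 := h (2 * m) (by omega)
  have h2 : (2 : ℝ) ^ m ≤ Module.finrank k (P (2 * m)) := by
    exact_mod_cast AlgA.two_pow_le_finrank hres m
  have h3 : ((2 * m : ℕ) : ℝ) ^ ((b : ℝ) - 1) ≤ ((2 * m : ℕ) : ℝ) ^ b := by
    rw [← Real.rpow_natCast]
    refine Real.rpow_le_rpow_of_exponent_le ?_ (by linarith)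
    exact_mod_cast (by omega : 1 ≤ 2 * m)
  have h4 := (h2.trans h1).trans (mul_le_mul_of_nonneg_left h3 hc.le)
  rw [← mul_div_assoc, div_lt_one (by positivity)] at hm
  push_cast at h4
  rw [mul_pow] at h4
  linarith
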